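/- Let d ≥ 2, let 1/d ≤ k ≤ 1, and let {ρ_{b,x}} (b = 1,…,d+1; x = 1,…,d) be a d-dimensional arbitrary-rank (d+1)-MUB set: each ρ_{b,x} is a positive semidefinite d×d complex matrix with Tr[ρ_{b,x}] = 1, Σ_{b,x} ρ_{b,x} = (d+1)·I, and Tr[ρ_{b,x} ρ_{b',x'}] = k if (b,x) = (b',x'), (1 − k)/(d − 1) if b = b' and x ≠ x', and 1/d if b ≠ b'. Let P = {Π_{b,x} = (1/(d+1))ρ_{b,x}} be the associated arbitrary-rank (d+1)-MUB POVM. Then for every ensemble F in dimension d, the mutual information satisfies I(F, P) ≤ log₂( d(k + 1)/(d+1) ); i.e., the informational power of any arbitrary-rank (d+1)-MUB POVM is at most log₂( d(k+1)/(d+1) ). -/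

import Mathlib

open Matrix Finset
open scoped BigOperators ComplexOrder

/-- The mutual information (in bits) of a finite joint probability distribution
`p : X → Y → ℝ`, with the convention `0·log₂ 0 = 0` (terms with `p x y = 0` vanish). -/
noncomputable def mutualInfo {X Y : Type*} [Fintype X] [Fintype Y] (p : X → Y → ℝ) : ℝ :=
  ∑ x, ∑ y, p x y * Real.logb 2 (p x y / ((∑ y', p x y') * (∑ x', p x' y)))

/-- `ρ` is a `d`-dimensional arbitrary-rank `(d+1)`-MUB set with parameter `k`:
`d(d+1)` unit-trace PSD matrices `ρ_{b,x}` summing to `(d+1)·I` whose pairwise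
Hilbert-Schmidt inner products are `k` on the diagonal, `(1−k)/(d−1)` within a basis,
and `1/d` across different bases. -/
noncomputable def IsGenMUB (d : ℕ) (k : ℝ)
    (ρ : Fin (d + 1) × Fin d → Matrix (Fin d) (Fin d) ℂ) : Prop :=
  (∀ bx, (ρ bx).PosSemidef) ∧ (∀ bx, (ρ bx).trace = 1) ∧
  (∑ bx, ρ bx = ((d : ℂ) + 1) • 1) ∧
  (∀ bx b'x' : Fin (d + 1) × Fin d, (ρ bx * ρ b'x').trace =
    if bx = b'x' then (k : ℂ)
    else if bx.1 = b'x'.1 then ((1 - (k : ℂ)) / ((d : ℂ) - 1))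
    else ((d : ℂ))⁻¹)

/-- A mutual information bound: if the output alphabet has at most `u⁻¹` letters and the squared
entries of each row sum to at most `u * R` times the square of the row sum, then the mutual
information is at most `log₂ R`. -/
lemma mutualInfo_le_logb {X Y : Type*} [Fintype X] [Fintype Y] (p : X → Y → ℝ)
    (hp : ∀ x y, 0 ≤ p x y) (hsum : ∑ x, ∑ y, p x y = 1) {u R : ℝ} (hu : 0 < u) (hR : 0 < R)
    (hcard : Fintype.card Y * u ≤ 1)
    (hrow : ∀ x, ∑ y, p x y ^ 2 ≤ u * R * (∑ y, p x y) ^ 2) :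
    mutualInfo p ≤ Real.logb 2 R := by
  set t : X → ℝ := fun x => ∑ y, p x y with ht
  set q : Y → ℝ := fun y => ∑ x, p x y with hq
  have hpt : ∀ x y, p x y ≤ t x := fun x y =>
    single_le_sum (f := fun y => p x y) (fun y _ => hp x y) (mem_univ y)
  have hpq : ∀ x y, p x y ≤ q y := fun x y =>
    single_le_sum (f := fun x => p x y) (fun x _ => hp x y) (mem_univ x)
  have hterm : ∀ x y, p x y * Real.log (p x y / (t x * q y)) ≤
      p x y * Real.log R + p x y ^ 2 / (u * R * t x) + p x y / q y * u - 2 * p x y := by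
    intro x y
    rcases (hp x y).eq_or_lt with h | h
    · simp [← h]
    have hT := h.trans_le (hpt x y)
    have hQ := h.trans_le (hpq x y)
    have hlog : Real.log (p x y / (t x * q y)) =
        Real.log R + Real.log (p x y / (u * R * t x)) + Real.log (u / q y) := by
      rw [← Real.log_mul (by positivity) (by positivity),
        ← Real.log_mul (by positivity) (by positivity)]
      congr 1
      field_simp
    have h1 := Real.log_le_sub_one_of_pos (show 0 < p x y / (u * R * t x) by positivity)
    have h2 := Real.log_le_sub_one_of_pos (show 0 < u / q y by positivity)
    have h3 : p x y * Real.log (p x y / (t x * q y)) ≤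
        p x y * (Real.log R + (p x y / (u * R * t x) - 1) + (u / q y - 1)) := by
      rw [hlog]
      gcongr
    refine h3.trans (le_of_eq ?_)
    ring
  have hA : ∑ x, ∑ y, p x y ^ 2 / (u * R * t x) ≤ 1 := by
    rw [← hsum]
    refine sum_le_sum fun x _ => ?_
    rw [← sum_div]
    change _ ≤ t x
    have h0 : 0 ≤ t x := sum_nonneg fun y _ => hp x y
    rcases h0.eq_or_lt with h | h
    · simp [← h]
    · rw [div_le_iff₀ (by positivity)]
      refine (hrow x).trans (le_of_eq ?_)
      change u * R * t x ^ 2 = _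
      ring
  have hB : ∑ x, ∑ y, p x y / q y * u ≤ 1 := by
    rw [sum_comm]
    refine le_trans (sum_le_sum (g := fun _ => u) fun y _ => ?_) (by simpa using hcard)
    rw [← sum_mul, ← sum_div]
    exact mul_le_of_le_one_left hu.le (div_self_le_one (q y))
  have hlog2 : 0 < Real.log 2 := Real.log_pos one_lt_two
  have hmain : ∑ x, ∑ y, p x y * Real.log (p x y / (t x * q y)) ≤ Real.log R := by
    refine (sum_le_sum fun x _ => sum_le_sum fun y _ => hterm x y).trans ?_
    have hsum' : ∑ x, ∑ y, p x y = 1 := hsum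
    simp only [sum_add_distrib, sum_sub_distrib, ← sum_mul, ← mul_sum, hsum'] at hA hB ⊢
    linarith
  calc mutualInfo p = (∑ x, ∑ y, p x y * Real.log (p x y / (t x * q y))) / Real.log 2 := by
        simp only [mutualInfo, Real.logb, sum_div, mul_div_assoc, ht, hq]
    _ ≤ Real.logb 2 R := div_le_div_of_nonneg_right hmain hlog2.le

/-- A Bessel inequality for a family whose Gram matrix is bounded above by `l`. -/
lemma sum_sq_le_of_gram_le {V ι : Type*} [AddCommGroup V] [Module ℝ V] [Fintype ι]
    (B : V →ₗ[ℝ] V →ₗ[ℝ] ℝ) (hsymm : ∀ v w, B v w = B w v) (hpos : ∀ v, 0 ≤ B v v)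
    (A : ι → V) {l : ℝ} (hl : 0 ≤ l)
    (hgram : ∀ c : ι → ℝ, ∑ i, ∑ j, c i * c j * B (A i) (A j) ≤ l * ∑ i, c i ^ 2) (v : V) :
    ∑ i, B v (A i) ^ 2 ≤ l * B v v := by
  set S := ∑ i, B v (A i) ^ 2 with hS
  set M := ∑ i, B v (A i) • A i with hM
  have hvM : B v M = S := by simp [hM, hS, sq]
  have hMM : B M M ≤ l * S := by
    refine le_trans (le_of_eq ?_) (hgram fun i => B v (A i))
    simp only [hM, map_sum, map_smul, LinearMap.sum_apply, LinearMap.smul_apply, smul_eq_mul,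
      mul_sum]
    rw [sum_comm]
    exact sum_congr rfl fun i _ => sum_congr rfl fun j _ => by ring
  have hquad : ∀ r : ℝ, 0 ≤ r ^ 2 * B v v - 2 * r * S + l * S := by
    intro r
    have h := hpos (r • v - M)
    simp only [map_sub, map_smul, LinearMap.sub_apply, LinearMap.smul_apply, smul_eq_mul,
      hsymm M v, hvM] at h
    nlinarith
  have hS0 : 0 ≤ S := sum_nonneg fun i _ => sq_nonneg _
  rcases hl.eq_or_lt with rfl | hl
  · by_contra! hlt
    rw [zero_mul] at hlt
    have hN := hpos v
    have h := hquad (S / (B v v + 1))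
    have h' : S / (B v v + 1) * (B v v + 1) = S := div_mul_cancel₀ _ (by positivity)
    have h'' : 0 < S / (B v v + 1) := by positivity
    nlinarith [mul_pos h'' h'']
  · nlinarith [hquad l]

/-- The real Hilbert-Schmidt form `Re Tr[Xᴴ Y]` on complex matrices. -/
noncomputable def hilbertSchmidt (n : Type*) [Fintype n] :
    Matrix n n ℂ →ₗ[ℝ] Matrix n n ℂ →ₗ[ℝ] ℝ :=
  LinearMap.mk₂ ℝ (fun X Y => (Xᴴ * Y).trace.re)
    (by intros; simp [add_mul]) (by intros; simp)
    (by intros; simp [mul_add]) (by intros; simp)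

lemma hilbertSchmidt_apply {n : Type*} [Fintype n] (X Y : Matrix n n ℂ) :
    hilbertSchmidt n X Y = (Xᴴ * Y).trace.re := rfl

lemma hilbertSchmidt_symm {n : Type*} [Fintype n] (X Y : Matrix n n ℂ) :
    hilbertSchmidt n X Y = hilbertSchmidt n Y X := by
  have h : (Xᴴ * Y).trace = star (Yᴴ * X).trace := by
    rw [← trace_conjTranspose, conjTranspose_mul, conjTranspose_conjTranspose]
  simp [hilbertSchmidt_apply, h]

lemma hilbertSchmidt_self_nonneg {n : Type*} [Fintype n] (X : Matrix n n ℂ) :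
    0 ≤ hilbertSchmidt n X X :=
  (Complex.le_def.mp (posSemidef_conjTranspose_mul_self X).trace_nonneg).1

open scoped MatrixOrder in
lemma Matrix.PosSemidef.trace_mul_re_nonneg {n : Type*} [Fintype n] {A B : Matrix n n ℂ}
    (hA : A.PosSemidef) (hB : B.PosSemidef) : 0 ≤ (A * B).trace.re := by
  classical
  obtain ⟨C, rfl⟩ := CStarAlgebra.nonneg_iff_eq_star_mul_self.mp hA.nonneg
  rw [star_eq_conjTranspose, mul_assoc, trace_mul_comm]
  exact (Complex.le_def.mp (hB.mul_mul_conjTranspose_same C).trace_nonneg).1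

lemma Matrix.PosSemidef.trace_mul_self_re_le {n : Type*} [Fintype n] {A : Matrix n n ℂ}
    (hA : A.PosSemidef) : (A * A).trace.re ≤ A.trace.re ^ 2 := by
  classical
  set D : Matrix n n ℂ := diagonal (RCLike.ofReal ∘ hA.1.eigenvalues) with hD
  have hAA : (A * A).trace = (D * D).trace := by
    conv_lhs => rw [hA.1.spectral_theorem, ← map_mul, Unitary.conjStarAlgAut_apply,
      trace_mul_cycle, Unitary.coe_star_mul_self, one_mul]
  rw [hAA, hA.1.trace_eq_sum_eigenvalues]
  have h := sum_sq_le_sq_sum_of_nonneg (s := univ) fun i _ => hA.eigenvalues_nonneg i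
  simpa [hD, diagonal_mul_diagonal, trace_diagonal, sq] using h

/-- Squared Hilbert-Schmidt overlaps of a positive semidefinite matrix with a generalized MUB
set. -/
lemma IsGenMUB.sum_sq_trace_le {d : ℕ} (hd : 2 ≤ d) {k : ℝ} (hk : 1 / (d : ℝ) ≤ k)
    {ρ : Fin (d + 1) × Fin d → Matrix (Fin d) (Fin d) ℂ} (hρ : IsGenMUB d k ρ)
    {A : Matrix (Fin d) (Fin d) ℂ} (hA : A.PosSemidef) :
    ∑ i, (A * ρ i).trace.re ^ 2 ≤ (k + 1) * A.trace.re ^ 2 := by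
  obtain ⟨hpsd, htr, hsum, hgram⟩ := hρ
  have hd2 : (2 : ℝ) ≤ d := by exact_mod_cast hd
  have hd0 : (d : ℝ) ≠ 0 := by positivity
  have hd1 : (0 : ℝ) < d - 1 := by linarith
  set c : ℝ := k - 1 / d with hc
  have hc0 : 0 ≤ c := sub_nonneg.mpr hk
  set l : ℝ := c * d / (d - 1) with hl
  set t := A.trace.re with ht
  set P : Fin (d + 1) × Fin d → Matrix (Fin d) (Fin d) ℂ :=
    fun i => ρ i - (1 / (d : ℝ)) • (1 : Matrix (Fin d) (Fin d) ℂ) with hP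
  have h11 : hilbertSchmidt (Fin d) 1 1 = d := by simp [hilbertSchmidt_apply]
  have hρ1 : ∀ i, hilbertSchmidt (Fin d) (ρ i) 1 = 1 := by
    intro i
    rw [hilbertSchmidt_symm]
    simp [hilbertSchmidt_apply, htr]
  have hA1 : hilbertSchmidt (Fin d) A 1 = t := by
    rw [hilbertSchmidt_symm]
    simp [hilbertSchmidt_apply, ht]
  have hρρ : ∀ i j, hilbertSchmidt (Fin d) (ρ i) (ρ j) =
      if i = j then k else if i.1 = j.1 then (1 - k) / (d - 1) else (d : ℝ)⁻¹ := by
    intro i j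
    rw [hilbertSchmidt_apply, (hpsd i).1, hgram]
    split_ifs
    · simp
    · rw [show ((1 - (k : ℂ)) / ((d : ℂ) - 1)) = (((1 - k) / (d - 1) : ℝ) : ℂ) by push_cast; rfl,
        Complex.ofReal_re]
    · rw [show ((d : ℂ))⁻¹ = (((d : ℝ)⁻¹ : ℝ) : ℂ) by push_cast; rfl, Complex.ofReal_re]
  have hPP : ∀ i j, hilbertSchmidt (Fin d) (P i) (P j) =
      (if i = j then l else 0) - (if i.1 = j.1 then c / (d - 1) else 0) := by
    intro i j
    simp only [hP, map_sub, map_smul, LinearMap.sub_apply, LinearMap.smul_apply, smul_eq_mul,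
      h11, hρ1, hilbertSchmidt_symm 1 (ρ _), hρρ]
    by_cases hij : i = j
    · subst hij
      simp only [if_true, hl, hc]
      field_simp
      ring
    · simp only [if_neg hij]
      split_ifs
      · simp only [hc]
        field_simp
        ring
      · field_simp
        ring
  have hbound : ∀ a : Fin (d + 1) × Fin d → ℝ,
      ∑ i, ∑ j, a i * a j * hilbertSchmidt (Fin d) (P i) (P j) ≤ l * ∑ i, a i ^ 2 := by
    intro a
    have hsq : ∑ i, ∑ j, a i * a j * (if i.1 = j.1 then c / (d - 1) else 0) =
        c / (d - 1) * ∑ b, (∑ x, a (b, x)) ^ 2 := by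
      simp only [Fintype.sum_prod_type, mul_ite, mul_zero, sq, sum_mul, mul_sum]
      refine sum_congr rfl fun b _ => sum_congr rfl fun x _ => ?_
      rw [sum_eq_single b]
      · simp only [if_true]
        exact sum_congr rfl fun _ _ => by ring
      · intro b' _ hb'
        simp [hb'.symm]
      · simp
    have hdiag : ∑ i, ∑ j, a i * a j * (if i = j then l else 0) = l * ∑ i, a i ^ 2 := by
      simp only [mul_ite, mul_zero, sum_ite_eq, mem_univ, if_true, mul_sum]
      exact sum_congr rfl fun i _ => by ring
    simp only [hPP, mul_sub, sum_sub_distrib, hsq, hdiag]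
    have : 0 ≤ c / (d - 1) * ∑ b, (∑ x, a (b, x)) ^ 2 := by positivity
    linarith
  have hbessel := sum_sq_le_of_gram_le (hilbertSchmidt (Fin d)) hilbertSchmidt_symm
    hilbertSchmidt_self_nonneg P (l := l) (by positivity) hbound
    (A - (t / d) • (1 : Matrix (Fin d) (Fin d) ℂ))
  have hcoord : ∀ i, hilbertSchmidt (Fin d) (A - (t / d) • (1 : Matrix (Fin d) (Fin d) ℂ)) (P i) =
      (A * ρ i).trace.re - t / d := by
    intro i
    have : hilbertSchmidt (Fin d) A (ρ i) = (A * ρ i).trace.re := by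
      rw [hilbertSchmidt_apply, hA.1]
    simp only [hP, map_sub, map_smul, LinearMap.sub_apply, LinearMap.smul_apply, smul_eq_mul,
      h11, hA1, hρ1, hilbertSchmidt_symm 1 (ρ _), this]
    field_simp
    ring
  have hnorm : hilbertSchmidt (Fin d) (A - (t / d) • (1 : Matrix (Fin d) (Fin d) ℂ))
      (A - (t / d) • (1 : Matrix (Fin d) (Fin d) ℂ)) ≤ t ^ 2 * ((d - 1) / d) := by
    have : hilbertSchmidt (Fin d) A A ≤ t ^ 2 := by
      rw [hilbertSchmidt_apply, hA.1]
      exact hA.trace_mul_self_re_le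
    simp only [map_sub, map_smul, LinearMap.sub_apply, LinearMap.smul_apply, smul_eq_mul,
      h11, hA1, hilbertSchmidt_symm 1 A]
    have h2 : t ^ 2 * ((d - 1) / d) = t ^ 2 - t / d * t - (t / d * t - t / d * (t / d * d)) := by
      field_simp
      ring
    linarith
  have htot : ∑ i, (A * ρ i).trace.re = (d + 1) * t := by
    rw [← Complex.re_sum, ← trace_sum, ← mul_sum, hsum]
    simp [ht]
  have hlN : l * (t ^ 2 * ((d - 1) / d)) = c * t ^ 2 := by
    simp only [hl]
    field_simp
  have hfin := hbessel.trans (mul_le_mul_of_nonneg_left hnorm (by positivity))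
  simp only [hcoord, sub_sq, sum_add_distrib, sum_sub_distrib, ← sum_mul, ← mul_sum, htot,
    hlN] at hfin
  simp only [sum_const, card_univ, Fintype.card_prod, Fintype.card_fin, nsmul_eq_mul] at hfin
  push_cast at hfin
  have hend : (k + 1) * t ^ 2 = c * t ^ 2 + 2 * ((d + 1) * t) * (t / d)
      - (d + 1) * d * (t / d) ^ 2 := by
    simp only [hc]
    field_simp
    ring
  linarith

/-- Informational power bound for arbitrary-rank `(d+1)`-MUB POVMs: for the POVM
`P = {(1/(d+1))ρ_{b,x}}` and any ensemble `{σ_x}`, the mutual information satisfies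
`I(F,P) ≤ log₂(d(k + 1)/(d+1))`. -/
theorem informational_power_bound_gen_mub {d : ℕ} (hd : 2 ≤ d) (k : ℝ)
    (hk1 : 1 / (d : ℝ) ≤ k) (hk2 : k ≤ 1)
    (ρ : Fin (d + 1) × Fin d → Matrix (Fin d) (Fin d) ℂ) (hρ : IsGenMUB d k ρ)
    {m : ℕ} (σ : Fin m → Matrix (Fin d) (Fin d) ℂ)
    (hσpsd : ∀ x, (σ x).PosSemidef) (hσtr : ∑ x, (σ x).trace = 1) :
    mutualInfo (fun x bx => (σ x * ((((d : ℂ) + 1))⁻¹ • ρ bx)).trace.re)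
      ≤ Real.logb 2 ((d : ℝ) * (k + 1) / ((d : ℝ) + 1)) := by
  have hd2 : (2 : ℝ) ≤ d := by exact_mod_cast hd
  have hk0 : 0 < k := lt_of_lt_of_le (by positivity) hk1
  have hentry : ∀ x i, (σ x * ((((d : ℂ) + 1))⁻¹ • ρ i)).trace.re =
      ((d : ℝ) + 1)⁻¹ * (σ x * ρ i).trace.re := by
    intro x i
    rw [mul_smul_comm, trace_smul, smul_eq_mul,
      show ((d : ℂ) + 1)⁻¹ = ((((d : ℝ) + 1)⁻¹ : ℝ) : ℂ) by push_cast; rfl, Complex.re_ofReal_mul]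
  have hrowsum : ∀ x, ∑ i, ((d : ℝ) + 1)⁻¹ * (σ x * ρ i).trace.re = (σ x).trace.re := by
    intro x
    rw [← mul_sum, ← Complex.re_sum, ← trace_sum, ← mul_sum, hρ.2.2.1]
    simp
    field_simp
  simp only [hentry]
  refine mutualInfo_le_logb _ (fun x i => ?_) ?_ (u := 1 / (d * (d + 1))) (by positivity)
    (by positivity) ?_ fun x => ?_
  · have := (hσpsd x).trace_mul_re_nonneg (hρ.1 i)
    positivity
  · simp only [hrowsum]
    rw [← Complex.re_sum, hσtr, Complex.one_re]
  · simp only [Fintype.card_prod, Fintype.card_fin]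
    push_cast
    refine le_of_eq ?_
    field_simp
  · simp only [hrowsum, mul_pow, ← mul_sum]
    refine (mul_le_mul_of_nonneg_left (hρ.sum_sq_trace_le hd hk1 (hσpsd x))
      (by positivity)).trans (le_of_eq ?_)
    field_simp
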